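/- arXiv:1608.07496 — 2 statements merged into one kernel-verified Lean document; each statement's English description precedes it below -/
import Mathlib

section
/- Let G : ℝ^d → ℝ (d ≥ 1) be Lebesgue integrable with ∫_{ℝ^d} G(x) dx = 0 and with finite first moment, i.e. ∫_{ℝ^d} |x|·|G(x)| dx < ∞. Let B_R ⊂ ℝ^d be the ball of radius R centered at the origin and ω_{d-1} the Lebesgue measure of the unit ball in ℝ^{d-1} (ω_0 = 1 when d = 1). Then lim_{R → ∞} R^{-(d-1)} ∫_{B_R} ∫_{B_R} G(x-y) dy dx = -ω_{d-1}·∫_{ℝ^d} |x|·G(x) dx. -/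
open MeasureTheory Filter

/-- The splitting of a vector of `ℝ^(n+1)` into its first coordinate and the remaining ones. -/
noncomputable def headTail (n : ℕ) (x : EuclideanSpace ℝ (Fin (n + 1))) :
    ℝ × EuclideanSpace ℝ (Fin n) :=
  (x 0, WithLp.toLp 2 fun i => x i.succ)

theorem norm_sq_eq_headTail {n : ℕ} (x : EuclideanSpace ℝ (Fin (n + 1))) :
    ‖x‖ ^ 2 = (headTail n x).1 ^ 2 + ‖(headTail n x).2‖ ^ 2 := by
  simp [EuclideanSpace.norm_sq_eq, Fin.sum_univ_succ, headTail]

theorem measurePreserving_headTail (n : ℕ) :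
    MeasurePreserving (headTail n) volume (volume.prod volume) := by
  have h1 := PiLp.volume_preserving_ofLp (Fin (n + 1))
  have h2 := volume_preserving_piFinSuccAbove (fun _ : Fin (n + 1) => ℝ) 0
  have h3 := (MeasurePreserving.id (volume : Measure ℝ)).prod (PiLp.volume_preserving_toLp (Fin n))
  exact h3.comp (h2.comp h1)

/-- The part of the ball of radius `R` not covered by its translate by `z`. -/
def crescent {E : Type*} [NormedAddCommGroup E] (R : ℝ) (z : E) : Set E :=
  {x | ‖x‖ ≤ R ∧ R < ‖x - z‖}

theorem measurableSet_crescent {E : Type*} [NormedAddCommGroup E] [MeasurableSpace E]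
    [BorelSpace E] (R : ℝ) (z : E) : MeasurableSet (crescent R z) := by
  rw [crescent, Set.ofPred_and]
  exact (measurableSet_le (by fun_prop) (by fun_prop)).inter
    (measurableSet_lt (by fun_prop) (by fun_prop))

theorem volume_crescent_eq_of_norm_eq {d : ℕ} (R : ℝ) {z w : EuclideanSpace ℝ (Fin d)}
    (h : ‖z‖ = ‖w‖) : volume (crescent R z) = volume (crescent R w) := by
  set e := (ℝ ∙ (z - w))ᗮ.reflection
  have he : e z = w := Submodule.reflection_sub h
  rw [← e.measurePreserving.measure_preimage (measurableSet_crescent R w).nullMeasurableSet]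
  congr 1
  ext x
  simp only [crescent, Set.mem_ofPred_eq, Set.mem_preimage, ← he, ← map_sub, e.norm_map]

/-- Slices of a crescent in direction of the translation. -/
theorem volume_crescent_eq_lintegral {n : ℕ} {R : ℝ} (hR : 0 ≤ R)
    (z : EuclideanSpace ℝ (Fin (n + 1))) :
    volume (crescent R z) = ∫⁻ y : EuclideanSpace ℝ (Fin n),
      volume {t : ℝ | t ^ 2 + ‖y‖ ^ 2 ≤ R ^ 2 ∧ R ^ 2 < (t - ‖z‖) ^ 2 + ‖y‖ ^ 2} := by
  have hS : MeasurableSet {p : ℝ × EuclideanSpace ℝ (Fin n) |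
      p.1 ^ 2 + ‖p.2‖ ^ 2 ≤ R ^ 2 ∧ R ^ 2 < (p.1 - ‖z‖) ^ 2 + ‖p.2‖ ^ 2} := by
    rw [Set.ofPred_and]
    exact (measurableSet_le (by fun_prop) (by fun_prop)).inter
      (measurableSet_lt (by fun_prop) (by fun_prop))
  rw [volume_crescent_eq_of_norm_eq R (w := EuclideanSpace.single 0 ‖z‖) (by simp)]
  have := Measure.prod_apply_symm (μ := (volume : Measure ℝ))
    (ν := (volume : Measure (EuclideanSpace ℝ (Fin n)))) hS
  refine Eq.trans ?_ this
  rw [← (measurePreserving_headTail n).measure_preimage hS.nullMeasurableSet]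
  congr 1
  ext x
  have h1 := norm_sq_eq_headTail (x - EuclideanSpace.single 0 ‖z‖)
  simp only [crescent, Set.mem_ofPred_eq, Set.mem_preimage, ← norm_sq_eq_headTail]
  rw [← sq_le_sq₀ (norm_nonneg x) hR, ← sq_lt_sq₀ hR (norm_nonneg _), h1]
  simp [headTail]

theorem volume_crescent_le {n : ℕ} {R : ℝ} (hR : 0 ≤ R) (z : EuclideanSpace ℝ (Fin (n + 1))) :
    volume (crescent R z) ≤
      ENNReal.ofReal ‖z‖ * volume (Metric.closedBall (0 : EuclideanSpace ℝ (Fin n)) R) := by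
  rw [volume_crescent_eq_lintegral hR,
    ← lintegral_indicator_const Metric.isClosed_closedBall.measurableSet]
  refine lintegral_mono fun y => ?_
  by_cases hy : y ∈ Metric.closedBall (0 : EuclideanSpace ℝ (Fin n)) R
  · rw [Set.indicator_of_mem hy]
    have hy' : ‖y‖ ^ 2 ≤ R ^ 2 := by
      have := mem_closedBall_zero_iff.1 hy
      gcongr
    set s := √(R ^ 2 - ‖y‖ ^ 2)
    have hs : s ^ 2 = R ^ 2 - ‖y‖ ^ 2 := Real.sq_sqrt (by linarith)
    have hs0 : 0 ≤ s := Real.sqrt_nonneg _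
    calc _ ≤ volume (Set.Icc (-s) (-s + ‖z‖)) := by
          refine measure_mono fun t ht => ?_
          obtain ⟨h1, h2⟩ := ht
          have h3 := abs_le.1 (abs_le_of_sq_le_sq (by linarith : t ^ 2 ≤ s ^ 2) hs0)
          refine ⟨h3.1, ?_⟩
          by_contra! h4
          have := norm_nonneg z
          nlinarith
      _ = ENNReal.ofReal ‖z‖ := by simp
  · rw [Set.indicator_of_notMem hy, nonpos_iff_eq_zero]
    convert measure_empty (μ := (volume : Measure ℝ))
    ext t
    simp only [Set.mem_ofPred_eq, Set.mem_empty_iff_false, iff_false, not_and]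
    intro h
    refine absurd ?_ hy
    rw [mem_closedBall_zero_iff]
    exact abs_le_of_sq_le_sq (by nlinarith) hR |> (le_abs_self _).trans

theorem le_volume_crescent {n : ℕ} {R : ℝ} (hR : 0 ≤ R) (z : EuclideanSpace ℝ (Fin (n + 1)))
    {r : ℝ} (hr : r ^ 2 + (‖z‖ / 2) ^ 2 ≤ R ^ 2) :
    ENNReal.ofReal ‖z‖ * volume (Metric.closedBall (0 : EuclideanSpace ℝ (Fin n)) r) ≤
      volume (crescent R z) := by
  rw [volume_crescent_eq_lintegral hR,
    ← lintegral_indicator_const Metric.isClosed_closedBall.measurableSet]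
  refine lintegral_mono (Set.indicator_le fun y hy => ?_)
  have hy' : ‖y‖ ^ 2 ≤ r ^ 2 := by
    have := mem_closedBall_zero_iff.1 hy
    gcongr
  set s := √(R ^ 2 - ‖y‖ ^ 2)
  have hs : s ^ 2 = R ^ 2 - ‖y‖ ^ 2 := Real.sq_sqrt (by nlinarith)
  have hsz : ‖z‖ / 2 ≤ s := Real.le_sqrt_of_sq_le (by linarith)
  have := norm_nonneg z
  calc ENNReal.ofReal ‖z‖ = volume (Set.Ioo (-s) (-s + ‖z‖)) := by simp
    _ ≤ _ := by
      refine measure_mono fun t ht => ?_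
      obtain ⟨h1, h2⟩ := ht
      constructor <;> nlinarith

theorem volume_real_closedBall_zero (n : ℕ) {r : ℝ} (hr : 0 ≤ r) :
    volume.real (Metric.closedBall (0 : EuclideanSpace ℝ (Fin n)) r) =
      r ^ n * volume.real (Metric.closedBall (0 : EuclideanSpace ℝ (Fin n)) 1) := by
  simpa using Measure.addHaar_real_closedBall' volume (0 : EuclideanSpace ℝ (Fin n)) hr

theorem volume_real_crescent_le {n : ℕ} {R : ℝ} (hR : 0 ≤ R)
    (z : EuclideanSpace ℝ (Fin (n + 1))) :
    volume.real (crescent R z) ≤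
      ‖z‖ * (R ^ n * volume.real (Metric.closedBall (0 : EuclideanSpace ℝ (Fin n)) 1)) := by
  have := ENNReal.toReal_mono (ENNReal.mul_ne_top ENNReal.ofReal_ne_top
    measure_closedBall_lt_top.ne) (volume_crescent_le hR z)
  rw [ENNReal.toReal_mul, ENNReal.toReal_ofReal (norm_nonneg z)] at this
  rw [← volume_real_closedBall_zero n hR]
  exact this

theorem crescent_subset_closedBall {E : Type*} [NormedAddCommGroup E] (R : ℝ) (z : E) :
    crescent R z ⊆ Metric.closedBall 0 R := fun _ hx => mem_closedBall_zero_iff.2 hx.1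

theorem le_volume_real_crescent {n : ℕ} {R : ℝ} (hR : 0 ≤ R)
    (z : EuclideanSpace ℝ (Fin (n + 1))) {r : ℝ} (hr0 : 0 ≤ r)
    (hr : r ^ 2 + (‖z‖ / 2) ^ 2 ≤ R ^ 2) :
    ‖z‖ * (r ^ n * volume.real (Metric.closedBall (0 : EuclideanSpace ℝ (Fin n)) 1)) ≤
      volume.real (crescent R z) := by
  have := ENNReal.toReal_mono (measure_ne_top_of_subset (crescent_subset_closedBall R z)
    measure_closedBall_lt_top.ne) (le_volume_crescent hR z hr)
  rw [ENNReal.toReal_mul, ENNReal.toReal_ofReal (norm_nonneg z)] at this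
  rw [← volume_real_closedBall_zero n hr0]
  exact this

theorem tendsto_volume_real_crescent_div {n : ℕ} (z : EuclideanSpace ℝ (Fin (n + 1))) :
    Tendsto (fun R : ℝ => volume.real (crescent R z) / R ^ n) atTop
      (nhds (‖z‖ * volume.real (Metric.closedBall (0 : EuclideanSpace ℝ (Fin n)) 1))) := by
  set ω := volume.real (Metric.closedBall (0 : EuclideanSpace ℝ (Fin n)) 1)
  have hlow : Tendsto (fun R : ℝ => ‖z‖ * (√(1 - (‖z‖ / 2 / R) ^ 2) ^ n * ω)) atTop
      (nhds (‖z‖ * ω)) := by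
    have h : Tendsto (fun R : ℝ => ‖z‖ / 2 / R) atTop (nhds 0) :=
      tendsto_const_nhds.div_atTop tendsto_id
    have h2 := ((((h.pow 2).const_sub 1).sqrt.pow n).mul_const ω).const_mul ‖z‖
    simpa using h2
  refine tendsto_of_tendsto_of_tendsto_of_le_of_le' hlow tendsto_const_nhds ?_ ?_
  · filter_upwards [eventually_gt_atTop 0, eventually_ge_atTop (‖z‖ / 2)] with R hR hRz
    have hq : (‖z‖ / 2 / R) ^ 2 ≤ 1 := by
      have : ‖z‖ / 2 / R ≤ 1 := (div_le_one hR).2 hRz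
      exact pow_le_one₀ (by positivity) this
    rw [le_div_iff₀ (by positivity)]
    have := le_volume_real_crescent hR.le z (r := R * √(1 - (‖z‖ / 2 / R) ^ 2))
      (by positivity) (by
        rw [mul_pow, Real.sq_sqrt (by linarith)]
        apply le_of_eq
        field_simp
        ring)
    rw [mul_pow] at this
    calc _ = _ := by ring
      _ ≤ _ := this
  · filter_upwards [eventually_gt_atTop 0] with R hR
    rw [div_le_iff₀ (by positivity)]
    calc _ ≤ _ := volume_real_crescent_le hR.le z
      _ = _ := by ring

theorem setIntegral_setIntegral_sub_eq {d : ℕ} {G : EuclideanSpace ℝ (Fin d) → ℝ}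
    (hG : Integrable G) (hG0 : ∫ x, G x = 0) (R : ℝ) :
    ∫ x in Metric.closedBall (0 : EuclideanSpace ℝ (Fin d)) R,
      ∫ y in Metric.closedBall (0 : EuclideanSpace ℝ (Fin d)) R, G (x - y) =
      -∫ z, volume.real (crescent R z) * G z := by
  set B := Metric.closedBall (0 : EuclideanSpace ℝ (Fin d)) R with hB
  have hBm : MeasurableSet B := Metric.isClosed_closedBall.measurableSet
  have hBfin : volume B ≠ ⊤ := measure_closedBall_lt_top.ne
  have hinner (x : EuclideanSpace ℝ (Fin d)) :
      ∫ y in B, G (x - y) = ∫ z, B.indicator 1 (x - z) * G z := by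
    rw [← integral_indicator hBm, ← integral_sub_left_eq_self _ volume x]
    refine integral_congr_ae (.of_forall fun z => ?_)
    by_cases h : x - z ∈ B <;> simp [h]
  have hint : Integrable (Function.uncurry fun x z : EuclideanSpace ℝ (Fin d) =>
      B.indicator 1 (x - z) * G z) ((volume.restrict B).prod volume) := by
    have h1 : Integrable (fun p : EuclideanSpace ℝ (Fin d) × EuclideanSpace ℝ (Fin d) =>
        (1 : ℝ) * G p.2) ((volume.restrict B).prod volume) :=
      have : IsFiniteMeasure (volume.restrict B) := ⟨by simpa using hBfin.lt_top⟩
      (integrable_const (1 : ℝ)).mul_prod hG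
    have h2 : Measurable fun p : EuclideanSpace ℝ (Fin d) × EuclideanSpace ℝ (Fin d) =>
        B.indicator (1 : EuclideanSpace ℝ (Fin d) → ℝ) (p.1 - p.2) :=
      (measurable_one.indicator hBm).comp (by fun_prop)
    simp only [one_mul] at h1
    refine h1.bdd_mul (c := 1) h2.aestronglyMeasurable (.of_forall fun p => ?_)
    by_cases h : p.1 - p.2 ∈ B <;> simp [h]
  have hslice (z : EuclideanSpace ℝ (Fin d)) :
      ∫ x in B, B.indicator (1 : EuclideanSpace ℝ (Fin d) → ℝ) (x - z) * G z =
        volume.real B * G z - volume.real (crescent R z) * G z := by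
    rw [integral_mul_const, ← sub_mul]
    congr 1
    have hsub := crescent_subset_closedBall R z
    rw [← measureReal_sdiff hsub (measurableSet_crescent R z) hBfin,
      ← integral_indicator hBm, ← integral_indicator_one (hBm.diff (measurableSet_crescent R z))]
    congr 1
    ext x
    by_cases h : ‖x‖ ≤ R <;> by_cases h' : ‖x - z‖ ≤ R <;>
      simp [Set.indicator, hB, crescent, h, h', not_lt.2, not_le.1]
  have hleft := hint.integral_prod_right
  simp only [Function.uncurry] at hleft
  have hc : Integrable fun z => volume.real (crescent R z) * G z := by
    refine ((hG.const_mul (volume.real B)).sub (hleft.congr (.of_forall hslice))).congr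
      (.of_forall fun z => ?_)
    simp
  simp_rw [hinner]
  rw [integral_integral_swap hint]
  simp_rw [hslice]
  rw [integral_sub (hG.const_mul _) hc, integral_const_mul, hG0, mul_zero, zero_sub]

theorem measurable_volume_real_crescent {d : ℕ} (R : ℝ) :
    Measurable fun z : EuclideanSpace ℝ (Fin d) => volume.real (crescent R z) := by
  have hS : MeasurableSet {p : EuclideanSpace ℝ (Fin d) × EuclideanSpace ℝ (Fin d) |
      ‖p.2‖ ≤ R ∧ R < ‖p.2 - p.1‖} := by
    rw [Set.ofPred_and]
    exact (measurableSet_le (by fun_prop) (by fun_prop)).inter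
      (measurableSet_lt (by fun_prop) (by fun_prop))
  exact (measurable_measure_prodMk_left hS).ennreal_toReal

/-- For an integrable `G` on `ℝ^d` with `∫ G = 0` and finite first moment, the double
integral of `G(x-y)` over the ball `B_R` grows like the surface area:
`R^{-(d-1)} ∫_{B_R} ∫_{B_R} G(x-y) dy dx → -ω_{d-1}·∫ ‖x‖·G(x) dx` as `R → ∞`. -/
theorem hyperuniform_variance_surface_order
    {d : ℕ} (hd : 1 ≤ d) (G : EuclideanSpace ℝ (Fin d) → ℝ)
    (hG : Integrable G) (hG0 : (∫ x, G x) = 0)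
    (hG1 : Integrable (fun x => ‖x‖ * G x)) :
    Tendsto
      (fun R : ℝ =>
        (∫ x in Metric.closedBall (0 : EuclideanSpace ℝ (Fin d)) R,
            ∫ y in Metric.closedBall (0 : EuclideanSpace ℝ (Fin d)) R, G (x - y)) /
          R ^ (d - 1))
      atTop
      (nhds
        (-((volume (Metric.closedBall (0 : EuclideanSpace ℝ (Fin (d - 1))) 1)).toReal *
            ∫ x, ‖x‖ * G x))) := by
  obtain ⟨n, rfl⟩ := Nat.exists_eq_add_of_le' hd
  simp only [Nat.add_sub_cancel, ← measureReal_def]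
  set ω := volume.real (Metric.closedBall (0 : EuclideanSpace ℝ (Fin n)) 1)
  simp_rw [setIntegral_setIntegral_sub_eq hG hG0, neg_div, ← integral_div, ← integral_const_mul]
  refine (tendsto_integral_filter_of_dominated_convergence (fun z => ω * ‖‖z‖ * G z‖)
    (.of_forall fun R => ?_) ?_ (hG1.norm.const_mul ω) (.of_forall fun z => ?_)).neg
  · exact ((measurable_volume_real_crescent R).aemeasurable.mul
      hG.aemeasurable).div_const _ |>.aestronglyMeasurable
  · filter_upwards [eventually_gt_atTop 0] with R hR
    refine .of_forall fun z => ?_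
    rw [norm_div, norm_mul, norm_mul, norm_norm, Real.norm_of_nonneg measureReal_nonneg,
      Real.norm_of_nonneg (by positivity : 0 ≤ R ^ n), div_le_iff₀ (by positivity)]
    calc _ ≤ ‖z‖ * (R ^ n * ω) * ‖G z‖ := by
          gcongr
          exact volume_real_crescent_le hR.le z
      _ = _ := by ring
  · have := (tendsto_volume_real_crescent_div z).mul_const (G z)
    convert this using 2 <;> ring
end

section
/- For the sine-kernel process, the variance of the number of points in the interval [0, L], namely Var(N([0,L])) = L - ∫₀^L ∫₀^L (sin(π(x-y))/(π(x-y)))² dx dy, grows logarithmically: lim_{L → ∞} (1/log L)·( L - ∫₀^L ∫₀^L (sin(π(x-y))/(π(x-y)))² dx dy ) = 1/π². -/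
open MeasureTheory Real Filter

/-- The Fejér kernel, in the variable for which it equals `sin² (n u) / sin² u`. -/
noncomputable def fejerSum (n : ℕ) (u : ℝ) : ℝ :=
  ∑ j ∈ Finset.range n, (1 + 2 * ∑ k ∈ Finset.range j, cos (2 * (k + 1) * u))

lemma sin_mul_dirichlet_sum (n : ℕ) (u : ℝ) :
    sin u * (1 + 2 * ∑ k ∈ Finset.range n, cos (2 * (k + 1) * u)) = sin ((2 * n + 1) * u) := by
  induction n with
  | zero => simp
  | succ n ih =>
    rw [Finset.sum_range_succ, mul_add 2, ← add_assoc, mul_add (sin u), ih]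
    have h1 : (2 * (n : ℝ) + 1) * u = 2 * (n + 1) * u - u := by ring
    have h2 : (2 * ((n + 1 : ℕ) : ℝ) + 1) * u = 2 * (n + 1) * u + u := by push_cast; ring
    rw [h1, h2, sin_sub, sin_add]
    ring

lemma sin_sq_mul_fejerSum (n : ℕ) (u : ℝ) :
    sin u ^ 2 * fejerSum n u = sin (n * u) ^ 2 := by
  induction n with
  | zero => simp [fejerSum]
  | succ n ih =>
    unfold fejerSum at ih ⊢
    rw [Finset.sum_range_succ, mul_add, ih, sq (sin u), mul_assoc, sin_mul_dirichlet_sum]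
    have h1 : (2 * (n : ℝ) + 1) * u = n * u + (n * u + u) := by ring
    have h2 : ((n + 1 : ℕ) : ℝ) * u = n * u + u := by push_cast; ring
    rw [h1, h2, sin_add (n * u) (n * u + u), sin_add (n * u) u, cos_add (n * u) u]
    have h3 := sin_sq_add_cos_sq u
    linear_combination (-sin (n * u) ^ 2) * h3

lemma continuous_fejerSum (n : ℕ) : Continuous (fejerSum n) := by
  unfold fejerSum
  fun_prop

lemma integral_fejerSum (n : ℕ) :
    ∫ t in (0:ℝ)..(1 / 2), fejerSum n (π * t) = n / 2 := by
  have hcos (k : ℕ) : ∫ t in (0:ℝ)..(1 / 2), cos (2 * (k + 1) * (π * t)) = 0 := by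
    have hc : (2 * ((k : ℝ) + 1) * π) ≠ 0 := by positivity
    have h : ∀ t : ℝ, cos (2 * (k + 1) * (π * t)) = cos (2 * (k + 1) * π * t) := by
      intro t; ring_nf
    simp_rw [h]
    rw [intervalIntegral.integral_comp_mul_left (fun x => cos x) hc, integral_cos]
    have : 2 * ((k : ℝ) + 1) * π * (1 / 2) = ((k + 1 : ℕ) : ℝ) * π := by push_cast; ring
    rw [this, sin_nat_mul_pi]
    simp
  unfold fejerSum
  rw [intervalIntegral.integral_finsetSum
    (fun j _ => Continuous.intervalIntegrable (by fun_prop) _ _)]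
  have hj (j : ℕ) : ∫ t in (0:ℝ)..(1 / 2),
      (1 + 2 * ∑ k ∈ Finset.range j, cos (2 * (k + 1) * (π * t))) = 1 / 2 := by
    rw [intervalIntegral.integral_add (by simp)
      (Continuous.intervalIntegrable (by fun_prop) _ _), intervalIntegral.integral_const_mul,
      intervalIntegral.integral_finsetSum
        (fun k _ => Continuous.intervalIntegrable (by fun_prop) _ _)]
    simp only [hcos]
    simp
  simp only [hj]
  simp
  ring

lemma abs_sq_div_sin_sq_sub_sq_div_sq_le_one {s u : ℝ} (hs : |s| ≤ 1) (h0 : 0 < u) (h1 : u < π / 2) :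
    |s ^ 2 / sin u ^ 2 - s ^ 2 / u ^ 2| ≤ 1 := by
  have hsin : 0 < sin u := sin_pos_of_pos_of_lt_pi h0 (by linarith [pi_pos])
  have hcos : 0 < cos u := cos_pos_of_mem_Ioo ⟨by linarith, h1⟩
  have hle : sin u ≤ u := sin_le h0.le
  have htan : u * cos u ≤ sin u := by
    have := le_tan h0.le h1
    rwa [tan_eq_sin_div_cos, le_div_iff₀ hcos] at this
  have h2 : 1 / sin u ^ 2 ≤ 1 + 1 / u ^ 2 := by
    have h3 : u ^ 2 * cos u ^ 2 ≤ sin u ^ 2 := by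
      rw [← mul_pow]; gcongr
    have h4 := sin_sq_add_cos_sq u
    rw [← sub_nonneg]
    have : 1 + 1 / u ^ 2 - 1 / sin u ^ 2
        = (sin u ^ 2 - u ^ 2 * cos u ^ 2) / (u ^ 2 * sin u ^ 2) := by
      field_simp
      linear_combination u ^ 2 * h4
    rw [this]
    exact div_nonneg (by linarith) (by positivity)
  have h5 : 1 / u ^ 2 ≤ 1 / sin u ^ 2 := by gcongr
  have h6 : s ^ 2 ≤ 1 := by rwa [sq_le_one_iff_abs_le_one]
  have h7 : s ^ 2 / sin u ^ 2 - s ^ 2 / u ^ 2 = s ^ 2 * (1 / sin u ^ 2 - 1 / u ^ 2) := by ring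
  rw [h7, abs_of_nonneg (mul_nonneg (sq_nonneg s) (by linarith))]
  exact mul_le_one₀ h6 (by linarith) (by linarith)

/-- The integral over `[0, x]` of the squared sine kernel. -/
noncomputable def sineSqIntegral (x : ℝ) : ℝ := ∫ r in (0:ℝ)..x, sinc (π * r) ^ 2

lemma continuous_sinc_pi_mul_sq : Continuous fun r : ℝ => sinc (π * r) ^ 2 := by
  have := continuous_sinc
  fun_prop

lemma hasDerivAt_sineSqIntegral (x : ℝ) :
    HasDerivAt sineSqIntegral (sinc (π * x) ^ 2) x :=
  continuous_sinc_pi_mul_sq.integral_hasStrictDerivAt 0 x |>.hasDerivAt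

lemma abs_sineSqIntegral_half_nat_sub_le {n : ℕ} (hn : 0 < n) :
    |sineSqIntegral (n / 2) - 1 / 2| ≤ 1 / (2 * n) := by
  have hn' : (0 : ℝ) < n := by exact_mod_cast hn
  have hF : n * sineSqIntegral (n / 2)
      = ∫ t in (0:ℝ)..(1 / 2), (n : ℝ) ^ 2 * sinc (π * (n * t)) ^ 2 := by
    rw [intervalIntegral.integral_const_mul,
      intervalIntegral.integral_comp_mul_left (fun r => sinc (π * r) ^ 2) hn'.ne']
    rw [mul_zero, mul_one_div, sineSqIntegral, smul_eq_mul]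
    field_simp
  have hc1 : Continuous fun t : ℝ => fejerSum n (π * t) :=
    (continuous_fejerSum n).comp (by fun_prop)
  have hc2 : Continuous fun t : ℝ => (n : ℝ) ^ 2 * sinc (π * (n * t)) ^ 2 :=
    continuous_const.mul
      (continuous_sinc_pi_mul_sq.comp (by fun_prop : Continuous fun t : ℝ => n * t))
  have hdiff : |(n : ℝ) / 2 - n * sineSqIntegral (n / 2)| ≤ 1 / 2 := by
    rw [hF, ← integral_fejerSum n, ← intervalIntegral.integral_sub
      (hc1.intervalIntegrable _ _) (hc2.intervalIntegrable _ _), ← Real.norm_eq_abs]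
    have hb := intervalIntegral.norm_integral_le_of_norm_le_const_ae (a := 0) (b := 1 / 2) (C := 1)
      (f := fun t : ℝ => fejerSum n (π * t) - (n : ℝ) ^ 2 * sinc (π * (n * t)) ^ 2) ?_
    · refine hb.trans ?_
      norm_num
    · have hne : ∀ᵐ t : ℝ, t ≠ 1 / 2 := by simp [ae_iff, measure_singleton]
      filter_upwards [hne] with t ht htm
      rw [Set.uIoc_of_le (by norm_num)] at htm
      have ht0 : 0 < t := htm.1
      have ht1 : t < 1 / 2 := lt_of_le_of_ne htm.2 ht
      have hu0 : 0 < π * t := by positivity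
      have hu1 : π * t < π / 2 := by nlinarith [pi_pos]
      have hsin : 0 < sin (π * t) := sin_pos_of_pos_of_lt_pi hu0 (by linarith [pi_pos])
      have e1 : fejerSum n (π * t) = sin (n * (π * t)) ^ 2 / sin (π * t) ^ 2 := by
        rw [← sin_sq_mul_fejerSum]; field_simp
      have e2 : (n : ℝ) ^ 2 * sinc (π * (n * t)) ^ 2 = sin (n * (π * t)) ^ 2 / (π * t) ^ 2 := by
        rw [sinc_of_ne_zero (by positivity), show π * (n * t) = n * (π * t) by ring]
        field_simp
      rw [e1, e2, Real.norm_eq_abs]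
      exact abs_sq_div_sin_sq_sub_sq_div_sq_le_one (abs_sin_le_one _) hu0 hu1
  have : (n : ℝ) / 2 - n * sineSqIntegral (n / 2)
      = -(n * (sineSqIntegral (n / 2) - 1 / 2)) := by ring
  rw [this, abs_neg, abs_mul, abs_of_pos hn'] at hdiff
  rw [le_div_iff₀ (by positivity)]
  linarith

lemma tendsto_sineSqIntegral_half_nat :
    Tendsto (fun n : ℕ => sineSqIntegral (n / 2)) atTop (nhds (1 / 2)) := by
  rw [tendsto_iff_norm_sub_tendsto_zero]
  refine squeeze_zero' (.of_forall fun _ => norm_nonneg _)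
    ((eventually_gt_atTop 0).mono fun n hn => abs_sineSqIntegral_half_nat_sub_le hn) ?_
  exact tendsto_const_nhds.div_atTop
    (tendsto_natCast_atTop_atTop.const_mul_atTop (by norm_num : (0 : ℝ) < 2))

/-- A differentiable function whose derivative is dominated by that of `-B` has increments
dominated by those of `-B`. -/
lemma abs_sub_le_of_abs_deriv_le {f f' B B' : ℝ → ℝ}
    (hf : ∀ x, 0 < x → HasDerivAt f (f' x) x) (hB : ∀ x, 0 < x → HasDerivAt B (B' x) x)
    (h : ∀ x, 0 < x → |f' x| ≤ -B' x) {x y : ℝ} (hx : 0 < x) (hxy : x ≤ y) :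
    |f y - f x| ≤ B x - B y := by
  have hpos : ∀ z ∈ interior (Set.Ioi (0:ℝ)), 0 < z := by
    intro z hz; rwa [interior_Ioi] at hz
  have hy : 0 < y := hx.trans_le hxy
  have h1 : AntitoneOn (fun z => f z + B z) (Set.Ioi 0) :=
    antitoneOn_of_hasDerivWithinAt_nonpos (convex_Ioi 0)
      (fun z hz => ((hf z hz).add (hB z hz)).continuousAt.continuousWithinAt)
      (fun z hz => ((hf z (hpos z hz)).add (hB z (hpos z hz))).hasDerivWithinAt)
      (fun z hz => by linarith [(abs_le.1 (h z (hpos z hz))).2])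
  have h2 : MonotoneOn (fun z => f z - B z) (Set.Ioi 0) :=
    monotoneOn_of_hasDerivWithinAt_nonneg (convex_Ioi 0)
      (fun z hz => ((hf z hz).sub (hB z hz)).continuousAt.continuousWithinAt)
      (fun z hz => ((hf z (hpos z hz)).sub (hB z (hpos z hz))).hasDerivWithinAt)
      (fun z hz => by linarith [(abs_le.1 (h z (hpos z hz))).1])
  have h3 := h1 hx hy hxy
  have h4 := h2 hx hy hxy
  simp only at h3 h4
  rw [abs_le]
  constructor <;> linarith

lemma hasDerivAt_const_div_sq {x : ℝ} (hx : x ≠ 0) (c : ℝ) :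
    HasDerivAt (fun y : ℝ => c / y ^ 2) (-(2 * c / x ^ 3)) x := by
  have := (hasDerivAt_const x c).div (hasDerivAt_pow 2 x) (pow_ne_zero 2 hx)
  refine this.congr_deriv ?_
  field_simp
  push_cast
  ring

lemma hasDerivAt_const_div {x : ℝ} (hx : x ≠ 0) (c : ℝ) :
    HasDerivAt (fun y : ℝ => c / y) (-(c / x ^ 2)) x := by
  have := (hasDerivAt_const x c).div (hasDerivAt_id x) hx
  refine this.congr_deriv ?_
  simp only [id_eq]
  ring

/-- `sineSqIntegral` corrected by the leading terms of its expansion at infinity. -/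
noncomputable def sineSqRemainder (x : ℝ) : ℝ :=
  sineSqIntegral x + 1 / (2 * π ^ 2) / x + sin (2 * π * x) * (1 / (4 * π ^ 3) / x ^ 2)

lemma hasDerivAt_sineSqRemainder {x : ℝ} (hx : 0 < x) :
    HasDerivAt sineSqRemainder (-(sin (2 * π * x) / (2 * π ^ 3 * x ^ 3))) x := by
  have hs : HasDerivAt (fun y : ℝ => sin (2 * π * y)) (cos (2 * π * x) * (2 * π)) x := by
    simpa using ((hasDerivAt_id x).const_mul (2 * π)).sin
  have := ((hasDerivAt_sineSqIntegral x).add (hasDerivAt_const_div hx.ne' (1 / (2 * π ^ 2)))).add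
    (hs.mul (hasDerivAt_const_div_sq hx.ne' (1 / (4 * π ^ 3))))
  refine this.congr_deriv ?_
  rw [sinc_of_ne_zero (by positivity), div_pow, sin_sq_eq_half_sub,
    show 2 * (π * x) = 2 * π * x by ring]
  field_simp
  ring

lemma tendsto_sineSqRemainder_half_nat :
    Tendsto (fun n : ℕ => sineSqRemainder (n / 2)) atTop (nhds (1 / 2)) := by
  have hx : Tendsto (fun n : ℕ => (n : ℝ) / 2) atTop atTop :=
    tendsto_natCast_atTop_atTop.atTop_div_const (by norm_num)
  have h1 : Tendsto (fun x : ℝ => 1 / (2 * π ^ 2) / x) atTop (nhds 0) :=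
    tendsto_const_nhds.div_atTop tendsto_id
  have h2 : Tendsto (fun x : ℝ => sin (2 * π * x) * (1 / (4 * π ^ 3) / x ^ 2)) atTop (nhds 0) :=
    bdd_le_mul_tendsto_zero' 1 (.of_forall fun x => abs_sin_le_one _)
      (tendsto_const_nhds.div_atTop (tendsto_pow_atTop two_ne_zero))
  simpa [sineSqRemainder] using
    (tendsto_sineSqIntegral_half_nat.add (h1.comp hx)).add (h2.comp hx)

lemma abs_sineSqRemainder_sub_le {x : ℝ} (hx : 0 < x) :
    |sineSqRemainder x - 1 / 2| ≤ (1 / 2) / x ^ 2 := by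
  have hle : ∀ y, x ≤ y → |sineSqRemainder y - sineSqRemainder x| ≤ (1 / 2) / x ^ 2 := by
    intro y hxy
    have := abs_sub_le_of_abs_deriv_le (fun z hz => hasDerivAt_sineSqRemainder hz)
      (fun z hz => hasDerivAt_const_div_sq hz.ne' (1 / 2)) ?_ hx hxy
    · have : 0 ≤ (1 / 2) / y ^ 2 := by positivity
      linarith
    · intro z hz
      rw [abs_neg, abs_div, abs_of_pos (by positivity : 0 < 2 * π ^ 3 * z ^ 3), neg_neg]
      have h1 : (1:ℝ) ≤ 2 * π ^ 3 := by
        have : (1:ℝ) ≤ π ^ 3 := one_le_pow₀ (by linarith [pi_gt_three])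
        linarith
      rw [mul_one_div_cancel two_ne_zero]
      exact div_le_div₀ zero_le_one (abs_sin_le_one _) (by positivity)
        (le_mul_of_one_le_left (by positivity) h1)
  rw [abs_sub_comm]
  refine le_of_tendsto ((tendsto_sineSqRemainder_half_nat.sub_const _).abs) ?_
  have hx : Tendsto (fun n : ℕ => (n : ℝ) / 2) atTop atTop :=
    tendsto_natCast_atTop_atTop.atTop_div_const (by norm_num)
  filter_upwards [hx.eventually_ge_atTop x] with n hn using hle _ hn

lemma abs_one_sub_two_mul_sineSqIntegral_sub_le {x : ℝ} (hx : 0 < x) :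
    |1 - 2 * sineSqIntegral x - 1 / π ^ 2 * x⁻¹| ≤ 2 / x ^ 2 := by
  have h := abs_sineSqRemainder_sub_le hx
  have hs : |sin (2 * π * x) * (1 / (4 * π ^ 3) / x ^ 2)| ≤ (1 / 2) / x ^ 2 := by
    rw [abs_mul, abs_of_pos (by positivity : 0 < 1 / (4 * π ^ 3) / x ^ 2)]
    refine (mul_le_of_le_one_left (by positivity) (abs_sin_le_one _)).trans ?_
    have : (1:ℝ) ≤ π ^ 3 := one_le_pow₀ (by linarith [pi_gt_three])
    gcongr
    linarith
  have e : 1 - 2 * sineSqIntegral x - 1 / π ^ 2 * x⁻¹ =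
      2 * (sin (2 * π * x) * (1 / (4 * π ^ 3) / x ^ 2)) - 2 * (sineSqRemainder x - 1 / 2) := by
    unfold sineSqRemainder
    field_simp
    ring
  have e2 : 2 / x ^ 2 = 2 * ((1 / 2) / x ^ 2) + 2 * ((1 / 2) / x ^ 2) := by ring
  rw [e, e2]
  refine (abs_sub _ _).trans ?_
  rw [abs_mul 2, abs_mul 2 (_ - _), abs_two]
  linarith

lemma sineSqIntegral_neg (x : ℝ) : sineSqIntegral (-x) = -sineSqIntegral x := by
  have h := intervalIntegral.integral_comp_neg (a := 0) (b := x) fun r => sinc (π * r) ^ 2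
  simp only [mul_neg, sinc_neg, neg_zero] at h
  rw [sineSqIntegral, intervalIntegral.integral_symm, ← h, sineSqIntegral]

lemma integral_sineKernel_sq (L : ℝ) :
    ∫ x in (0:ℝ)..L, ∫ y in (0:ℝ)..L, (sin (π * (x - y)) / (π * (x - y))) ^ 2
      = 2 * ∫ x in (0:ℝ)..L, sineSqIntegral x := by
  have hcont : Continuous sineSqIntegral :=
    continuous_iff_continuousAt.2 fun x => (hasDerivAt_sineSqIntegral x).continuousAt
  have hinner (x : ℝ) : ∫ y in (0:ℝ)..L, (sin (π * (x - y)) / (π * (x - y))) ^ 2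
      = sineSqIntegral x + sineSqIntegral (L - x) := by
    have h1 : ∫ y in (0:ℝ)..L, (sin (π * (x - y)) / (π * (x - y))) ^ 2
        = ∫ y in (0:ℝ)..L, sinc (π * (x - y)) ^ 2 := by
      refine intervalIntegral.integral_congr_ae ?_
      have hne : ∀ᵐ y : ℝ, y ≠ x := by simp [ae_iff, measure_singleton]
      filter_upwards [hne] with y hy _
      rw [sinc_of_ne_zero (mul_ne_zero pi_ne_zero (sub_ne_zero.2 hy.symm))]
    rw [h1, intervalIntegral.integral_comp_sub_left (fun r => sinc (π * r) ^ 2) x, sub_zero,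
      ← intervalIntegral.integral_interval_sub_left (a := 0)
        (continuous_sinc_pi_mul_sq.intervalIntegrable _ _)
        (continuous_sinc_pi_mul_sq.intervalIntegrable _ _),
      ← neg_sub L x]
    change sineSqIntegral x - sineSqIntegral (-(L - x)) = _
    rw [sineSqIntegral_neg, sub_neg_eq_add]
  simp only [hinner]
  rw [intervalIntegral.integral_add (hcont.intervalIntegrable _ _)
    (Continuous.intervalIntegrable (by fun_prop) _ _),
    intervalIntegral.integral_comp_sub_left sineSqIntegral L, sub_self, sub_zero, two_mul]

/-- Logarithmic growth of the number variance of the sine-kernel process: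
`(L - ∫₀^L ∫₀^L (sin(π(x-y))/(π(x-y)))² dx dy) / log L → 1/π²` as `L → ∞`. -/
theorem sine_kernel_variance_log_growth :
    Tendsto
      (fun L : ℝ =>
        (L - ∫ x in (0:ℝ)..L, ∫ y in (0:ℝ)..L,
            (Real.sin (π * (x - y)) / (π * (x - y))) ^ 2) / Real.log L)
      atTop (nhds (1 / π ^ 2)) := by
  simp only [integral_sineKernel_sq]
  have hcont : Continuous sineSqIntegral :=
    continuous_iff_continuousAt.2 fun x => (hasDerivAt_sineSqIntegral x).continuousAt
  let W : ℝ → ℝ := fun L => L - 2 * (∫ x in (0:ℝ)..L, sineSqIntegral x) - 1 / π ^ 2 * log L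
  have hW : ∀ x, 0 < x →
      HasDerivAt W (1 - 2 * sineSqIntegral x - 1 / π ^ 2 * x⁻¹) x := fun x hx =>
    ((hasDerivAt_id x).sub ((hcont.integral_hasStrictDerivAt 0 x).hasDerivAt.const_mul 2)).sub
      ((hasDerivAt_log hx.ne').const_mul _)
  have hbound : ∀ L, 1 ≤ L → |W L| ≤ |W 1| + 2 := by
    intro L hL
    have h := abs_sub_le_of_abs_deriv_le hW (fun z hz => hasDerivAt_const_div hz.ne' 2)
      (fun z hz => by
        rw [neg_neg]; exact abs_one_sub_two_mul_sineSqIntegral_sub_le hz) one_pos hL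
    have h2 : 0 ≤ 2 / L := by positivity
    have h3 := abs_sub_abs_le_abs_sub (W L) (W 1)
    linarith
  have hlim : Tendsto (fun L => W L / log L) atTop (nhds 0) := by
    refine squeeze_zero_norm' (a := fun L => (|W 1| + 2) / log L) ?_
      (tendsto_const_nhds.div_atTop tendsto_log_atTop)
    filter_upwards [eventually_ge_atTop 1] with L hL
    rw [Real.norm_eq_abs, abs_div, abs_of_nonneg (log_nonneg hL)]
    exact div_le_div_of_nonneg_right (hbound L hL) (log_nonneg hL)
  have hsum := hlim.add_const (1 / π ^ 2)
  rw [zero_add] at hsum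
  refine hsum.congr' ?_
  filter_upwards [eventually_gt_atTop 1] with L hL
  have := (log_pos hL).ne'
  simp only [W]
  field_simp
  ring
end
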